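/- arXiv:1811.01086 — 3 statements merged into one kernel-verified Lean document; each statement's English description precedes it below -/
import Mathlib

section
/- Let 𝒳 ⊆ ℝ^n be compact and let K ⊆ ℝ^n be a compact set containing φ_{x,t}^d(s) for all x ∈ 𝒳, t ∈ [0,T], s ∈ [t,T] and all admissible uncertainties d on [t,T]. If L_l ≥ 0 satisfies |l_j(x) − l_j(y)| ≤ L_l‖x − y‖ for all x, y ∈ K and all j = 1,…,n_TR, and L_g ≥ 0 satisfies |g_i(x,s) − g_i(y,s)| ≤ L_g‖x − y‖ for all x, y ∈ K, all s ∈ [0,T] and all i = 1,…,n_X, then |u(x₁,t) − u(x₂,t)| ≤ max{L_l, L_g} · e^{L_F T} · ‖x₁ − x₂‖ for all x₁, x₂ ∈ 𝒳 and all t ∈ [0,T]. -/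
open Set MeasureTheory RealInnerProductSpace Filter Topology

noncomputable section

abbrev EucSp (n : ℕ) : Type := EuclideanSpace ℝ (Fin n)

/-- An admissible uncertainty on `[t, T]`: a measurable map taking values in `D` there. -/
def Admissible {m : ℕ} (D : Set (EucSp m)) (t T : ℝ) (d : ℝ → EucSp m) : Prop :=
  Measurable d ∧ ∀ s ∈ Set.Icc t T, d s ∈ D

/-- `y` solves `ẏ(s) = F (y s) (d s)` on `[t, T]` with `y t = x` (integral form,
equivalent to absolute continuity together with the a.e. differential equation). -/
def IsTraj {n m : ℕ} (F : EucSp n → EucSp m → EucSp n) (d : ℝ → EucSp m)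
    (t T : ℝ) (x : EucSp n) (y : ℝ → EucSp n) : Prop :=
  y t = x ∧ ∀ s ∈ Set.Icc t T, y s = x + ∫ r in t..s, F (y r) (d r)

/-- The payoff of a trajectory `y` on `[t, T]`:
`max { max_j l_j (y T), max_i sup_{s ∈ [t,T]} g_i (y s, s) }`. -/
def payoff {n nX nTR : ℕ} (g : Fin nX → EucSp n → ℝ → ℝ) (l : Fin nTR → EucSp n → ℝ)
    (t T : ℝ) (y : ℝ → EucSp n) : ℝ :=
  max (⨆ j, l j (y T)) (⨆ i, sSup ((fun s => g i (y s) s) '' Set.Icc t T))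

/-- The defining property of the value function `u`: for `(x, t) ∈ ℝⁿ × [0, T]`,
`u (x, t)` is the supremum of the payoffs over all admissible uncertainties on `[t, T]`
(the trajectory being the unique solution of the ODE driven by the uncertainty). -/
def IsValueFun {n m nX nTR : ℕ} (F : EucSp n → EucSp m → EucSp n) (D : Set (EucSp m))
    (g : Fin nX → EucSp n → ℝ → ℝ) (l : Fin nTR → EucSp n → ℝ) (T : ℝ)
    (u : EucSp n → ℝ → ℝ) : Prop :=
  ∀ x : EucSp n, ∀ t ∈ Set.Icc (0:ℝ) T,
    u x t = sSup {r | ∃ d y, Admissible D t T d ∧ IsTraj F d t T x y ∧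
      r = payoff g l t T y}

/-- The Hamiltonian `H(x, p) = max_{d ∈ D} ⟪p, F x d⟫`. -/
def Ham {n m : ℕ} (F : EucSp n → EucSp m → EucSp n) (D : Set (EucSp m))
    (x p : EucSp n) : ℝ :=
  sSup ((fun d => ⟪p, F x d⟫) '' D)

/-- Viscosity super-solution of `max{∂ₜ w + H(x, ∇ₓ w), maxᵢ gᵢ(x,t) - w} = 0` on
`ℝⁿ × [0, T]`: a lower semicontinuous function such that for every smooth test function
`ψ` such that `w - ψ` attains a local minimum at `(x₀, t₀) ∈ ℝⁿ × [0, T]`, one has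
`max{∂ₜ ψ(x₀,t₀) + H(x₀, ∇ₓ ψ(x₀,t₀)), maxᵢ gᵢ(x₀,t₀) - w(x₀,t₀)} ≤ 0`. -/
def ViscSuper {n m nX : ℕ} (F : EucSp n → EucSp m → EucSp n) (D : Set (EucSp m))
    (g : Fin nX → EucSp n → ℝ → ℝ) (T : ℝ) (w : EucSp n → ℝ → ℝ) : Prop :=
  LowerSemicontinuousOn (fun p : EucSp n × ℝ => w p.1 p.2) (Set.univ ×ˢ Set.Icc 0 T) ∧
  ∀ ψ : EucSp n → ℝ → ℝ, ContDiff ℝ (⊤ : ℕ∞) (fun p : EucSp n × ℝ => ψ p.1 p.2) →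
    ∀ x₀ : EucSp n, ∀ t₀ ∈ Set.Icc (0:ℝ) T,
      IsLocalMinOn (fun p : EucSp n × ℝ => w p.1 p.2 - ψ p.1 p.2)
        (Set.univ ×ˢ Set.Icc 0 T) (x₀, t₀) →
      max (deriv (ψ x₀) t₀ + Ham F D x₀ (gradient (fun z => ψ z t₀) x₀))
        ((⨆ i, g i x₀ t₀) - w x₀ t₀) ≤ 0

/-- Viscosity sub-solution of `max{∂ₜ w + H(x, ∇ₓ w), maxᵢ gᵢ(x,t) - w} = 0` on
`ℝⁿ × [0, T]`. -/
def ViscSub {n m nX : ℕ} (F : EucSp n → EucSp m → EucSp n) (D : Set (EucSp m))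
    (g : Fin nX → EucSp n → ℝ → ℝ) (T : ℝ) (w : EucSp n → ℝ → ℝ) : Prop :=
  UpperSemicontinuousOn (fun p : EucSp n × ℝ => w p.1 p.2) (Set.univ ×ˢ Set.Icc 0 T) ∧
  ∀ ψ : EucSp n → ℝ → ℝ, ContDiff ℝ (⊤ : ℕ∞) (fun p : EucSp n × ℝ => ψ p.1 p.2) →
    ∀ x₀ : EucSp n, ∀ t₀ ∈ Set.Icc (0:ℝ) T,
      IsLocalMaxOn (fun p : EucSp n × ℝ => w p.1 p.2 - ψ p.1 p.2)
        (Set.univ ×ˢ Set.Icc 0 T) (x₀, t₀) →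
      0 ≤ max (deriv (ψ x₀) t₀ + Ham F D x₀ (gradient (fun z => ψ z t₀) x₀))
        ((⨆ i, g i x₀ t₀) - w x₀ t₀)

/-- The backward reachable set at time `t` (horizon `T`) of the target `{maxⱼ lⱼ ≤ 0}`
under state constraints `{maxᵢ gᵢ(·, s) ≤ 0}`, for the dynamics `f` driven by
uncertainties in `D`: the set of `x` such that for every admissible uncertainty the
(unique) solution extends to all of `[t, T]`, respects the state constraints there,
and ends up in the target at time `T`. -/
def Reach {n m nX nTR : ℕ} (f : EucSp n → EucSp m → EucSp n) (D : Set (EucSp m))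
    (g : Fin nX → EucSp n → ℝ → ℝ) (l : Fin nTR → EucSp n → ℝ)
    (t T : ℝ) : Set (EucSp n) :=
  {x | ∀ d, Admissible D t T d → ∃ y, IsTraj f d t T x y ∧
    (∀ s ∈ Set.Icc t T, ∀ i, g i (y s) s ≤ 0) ∧ ∀ j, l j (y T) ≤ 0}

/-- A continuous vector field along a bounded measurable curve and an admissible uncertainty
is integrable. -/
theorem integrableOn_vectorField {n m : ℕ} {F : EucSp n → EucSp m → EucSp n}
    (hFcont : Continuous fun p : EucSp n × EucSp m => F p.1 p.2)
    {D : Set (EucSp m)} (hD : IsCompact D) {K : Set (EucSp n)} (hK : IsCompact K)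
    {t T : ℝ} {d : ℝ → EucSp m} (hd : Admissible D t T d) {y : ℝ → EucSp n}
    (hy : AEStronglyMeasurable y (volume.restrict (Icc t T)))
    (hyK : ∀ s ∈ Icc t T, y s ∈ K) :
    IntegrableOn (fun r => F (y r) (d r)) (Icc t T) := by
  obtain ⟨M, hM⟩ := (hK.prod hD).exists_bound_of_continuousOn hFcont.continuousOn
  refine IntegrableOn.of_bound (by simp) ?_ M ?_
  · exact hFcont.comp_aestronglyMeasurable (hy.prodMk hd.1.aestronglyMeasurable)
  · filter_upwards [ae_restrict_mem measurableSet_Icc] with s hs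
    exact hM (y s, d s) ⟨hyK s hs, hd.2 s hs⟩

/-- A bounded trajectory has an integrable velocity: the integral in `IsTraj` never takes
its default value. -/
theorem IsTraj.integrableOn {n m : ℕ} {F : EucSp n → EucSp m → EucSp n}
    (hFcont : Continuous fun p : EucSp n × EucSp m => F p.1 p.2)
    {D : Set (EucSp m)} (hD : IsCompact D) {K : Set (EucSp n)} (hK : IsCompact K)
    {t T : ℝ} {d : ℝ → EucSp m} (hd : Admissible D t T d) {x : EucSp n} {y : ℝ → EucSp n}
    (hy : IsTraj F d t T x y) (hyK : ∀ s ∈ Icc t T, y s ∈ K) :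
    IntegrableOn (fun r => F (y r) (d r)) (Icc t T) := by
  refine integrableOn_vectorField hFcont hD hK hd ?_ hyK
  set A : Set ℝ := {s ∈ Icc t T | IntervalIntegrable (fun r => F (y r) (d r)) volume t s}
  have hAsub : A ⊆ Icc t T := fun s hs => hs.1
  have hdown : ∀ s ∈ A, Icc t s ⊆ A := by
    intro s hs r hr
    refine ⟨⟨hr.1, hr.2.trans hs.1.2⟩, hs.2.mono_set ?_⟩
    rw [uIcc_of_le hr.1, uIcc_of_le hs.1.1]
    exact Icc_subset_Icc_right hr.2
  have hcont_Icc : ∀ s ∈ A, ContinuousOn y (Icc t s) := by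
    intro s hs
    have h := intervalIntegral.continuousOn_primitive_interval' hs.2 left_mem_uIcc
    rw [uIcc_of_le hs.1.1] at h
    exact (continuousOn_const.add h).congr fun r hr => hy.2 r ⟨hr.1, hr.2.trans hs.1.2⟩
  have hcont : ContinuousOn y A := by
    intro s hs
    by_cases h : ∃ s' ∈ A, s < s'
    · obtain ⟨s', hs', hlt⟩ := h
      refine (hcont_Icc s' hs' s ⟨hs.1.1, hlt.le⟩).mono_of_mem_nhdsWithin ?_
      filter_upwards [self_mem_nhdsWithin, mem_nhdsWithin_of_mem_nhds (Iio_mem_nhds hlt)]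
        with r hr hr'
      exact ⟨hr.1.1, le_of_lt hr'⟩
    · push Not at h
      exact (hcont_Icc s hs s ⟨hs.1.1, le_rfl⟩).mono fun r hr => ⟨hr.1.1, h r hr⟩
  have hAmeas : MeasurableSet A := by
    refine OrdConnected.measurableSet ⟨fun a ha b hb c hc => ?_⟩
    exact hdown b hb ⟨ha.1.1.trans hc.1, hc.2⟩
  have hB : AEStronglyMeasurable y (volume.restrict (Icc t T \ A)) := by
    refine (aestronglyMeasurable_const (b := x)).congr ?_
    filter_upwards [ae_restrict_mem (measurableSet_Icc.diff hAmeas)] with s hs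
    rw [hy.2 s hs.1, intervalIntegral.integral_undef fun h => hs.2 ⟨hs.1, h⟩, add_zero]
  rw [← union_sdiff_cancel hAsub]
  exact aestronglyMeasurable_union_iff.2 ⟨hcont.aestronglyMeasurable hAmeas, hB⟩

theorem IsTraj.continuousOn {n m : ℕ} {F : EucSp n → EucSp m → EucSp n} {t T : ℝ}
    (htT : t ≤ T) {d : ℝ → EucSp m} {x : EucSp n} {y : ℝ → EucSp n} (hy : IsTraj F d t T x y)
    (hint : IntegrableOn (fun r => F (y r) (d r)) (Icc t T)) : ContinuousOn y (Icc t T) := by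
  rw [← uIcc_of_le htT] at hint
  have h := intervalIntegral.continuousOn_primitive_interval hint
  rw [uIcc_of_le htT] at h
  exact (continuousOn_const.add h).congr hy.2

/-- Grönwall's inequality in integral form. -/
theorem le_mul_exp_of_le_add_integral {φ : ℝ → ℝ} {t T δ L : ℝ} (hL : 0 ≤ L)
    (hφ : ContinuousOn φ (Icc t T)) (hφ0 : ∀ s ∈ Icc t T, 0 ≤ φ s)
    (h : ∀ s ∈ Icc t T, φ s ≤ δ + ∫ r in t..s, L * φ r) :
    ∀ s ∈ Icc t T, φ s ≤ δ * Real.exp (L * (s - t)) := by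
  intro s hs
  have htT : t ≤ T := hs.1.trans hs.2
  set ψ : ℝ → ℝ := IccExtend htT ((Icc t T).domRestrict φ) with hψ
  have hψc : Continuous ψ := (continuousOn_iff_continuous_domRestrict.1 hφ).Icc_extend'
  have hψφ : ∀ r ∈ Icc t T, ψ r = φ r := fun r hr => by simp [hψ, IccExtend_of_mem _ _ hr]
  set G : ℝ → ℝ := fun s => δ + ∫ r in t..s, L * ψ r with hG
  have hGd : ∀ s, HasDerivAt G (L * ψ s) s := fun s =>
    ((continuous_const.mul hψc).integral_hasStrictDerivAt t s).hasDerivAt.const_add δ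
  have hφG : ∀ s ∈ Icc t T, φ s ≤ G s := by
    intro s hs
    refine (h s hs).trans_eq ?_
    simp only [hG]
    congr 1
    refine intervalIntegral.integral_congr fun r hr => ?_
    rw [uIcc_of_le hs.1] at hr
    simp only [hψφ r ⟨hr.1, hr.2.trans hs.2⟩]
  have hGt : G t = δ := by simp [hG]
  have hδ : 0 ≤ δ := by
    have ht : t ∈ Icc t T := left_mem_Icc.2 htT
    exact (hφ0 t ht).trans ((hφG t ht).trans_eq hGt)
  have key := norm_le_gronwallBound_of_norm_deriv_right_le (f := G) (f' := fun s => L * ψ s)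
    (δ := δ) (K := L) (ε := 0) (a := t) (b := T)
    (fun s _ => (hGd s).continuousAt.continuousWithinAt)
    (fun s _ => (hGd s).hasDerivWithinAt) (by rw [hGt, Real.norm_of_nonneg hδ]) (by
      intro r hr
      have hr' : r ∈ Icc t T := ⟨hr.1, hr.2.le⟩
      rw [hψφ r hr', Real.norm_of_nonneg (mul_nonneg hL (hφ0 r hr')), add_zero]
      exact mul_le_mul_of_nonneg_left ((hφG r hr').trans (le_abs_self _)) hL) s hs
  rw [gronwallBound_ε0] at key
  exact (hφG s hs).trans ((le_abs_self _).trans key)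

/-- Two trajectories driven by the same uncertainty diverge at most exponentially. -/
theorem IsTraj.norm_sub_le {n m : ℕ} {F : EucSp n → EucSp m → EucSp n}
    {D : Set (EucSp m)} {LF : ℝ} (hLF : 0 ≤ LF)
    (hFlip : ∀ x y : EucSp n, ∀ d ∈ D, ‖F x d - F y d‖ ≤ LF * ‖x - y‖)
    {t T : ℝ} (htT : t ≤ T) {d : ℝ → EucSp m} (hd : Admissible D t T d)
    {x₁ x₂ : EucSp n} {y₁ y₂ : ℝ → EucSp n}
    (hy₁ : IsTraj F d t T x₁ y₁) (hy₂ : IsTraj F d t T x₂ y₂)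
    (hint₁ : IntegrableOn (fun r => F (y₁ r) (d r)) (Icc t T))
    (hint₂ : IntegrableOn (fun r => F (y₂ r) (d r)) (Icc t T)) :
    ∀ s ∈ Icc t T, ‖y₁ s - y₂ s‖ ≤ ‖x₁ - x₂‖ * Real.exp (LF * (s - t)) := by
  have hc : ContinuousOn (fun s => ‖y₁ s - y₂ s‖) (Icc t T) :=
    ((hy₁.continuousOn htT hint₁).sub (hy₂.continuousOn htT hint₂)).norm
  refine le_mul_exp_of_le_add_integral hLF hc (fun _ _ => norm_nonneg _) fun s hs => ?_
  have hsub : uIcc t s ⊆ Icc t T := by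
    rw [uIcc_of_le hs.1]
    exact Icc_subset_Icc_right hs.2
  have hi₁ := (hint₁.mono_set hsub).intervalIntegrable
  have hi₂ := (hint₂.mono_set hsub).intervalIntegrable
  rw [hy₁.2 s hs, hy₂.2 s hs, add_sub_add_comm, ← intervalIntegral.integral_sub hi₁ hi₂]
  refine (norm_add_le _ _).trans (add_le_add le_rfl ?_)
  refine intervalIntegral.norm_integral_le_of_norm_le hs.1 (ae_of_all _ fun r hr => ?_)
    ((continuousOn_const.mul (hc.mono hsub)).intervalIntegrable)
  exact hFlip _ _ _ (hd.2 r ⟨hr.1.le, hr.2.trans hs.2⟩)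

theorem exp_neg_mul_integral_exp_le {t s lam : ℝ} (hlam : 0 < lam) :
    Real.exp (-(lam * s)) * ∫ r in t..s, Real.exp (lam * r) ≤ 1 / lam := by
  have h : ∫ r in t..s, Real.exp (lam * r) =
      (Real.exp (lam * s) - Real.exp (lam * t)) / lam := by
    rw [intervalIntegral.integral_comp_mul_left _ hlam.ne', integral_exp, smul_eq_mul,
      inv_mul_eq_div]
  rw [h, mul_div_assoc', mul_sub, ← Real.exp_add, neg_add_cancel, Real.exp_zero]
  gcongr
  linarith [mul_pos (Real.exp_pos (-(lam * s))) (Real.exp_pos (lam * t))]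

/-- Global existence of trajectories for a measurable uncertainty, by the contraction principle
for the exponentially weighted Picard operator. -/
theorem exists_isTraj {n m : ℕ} {F : EucSp n → EucSp m → EucSp n}
    (hFcont : Continuous fun p : EucSp n × EucSp m => F p.1 p.2)
    {D : Set (EucSp m)} (hD : IsCompact D) {LF : ℝ} (hLF : 0 ≤ LF)
    (hFlip : ∀ x y : EucSp n, ∀ d ∈ D, ‖F x d - F y d‖ ≤ LF * ‖x - y‖)
    {t T : ℝ} (htT : t ≤ T) {d : ℝ → EucSp m} (hd : Admissible D t T d) (x : EucSp n) :
    ∃ y, IsTraj F d t T x y := by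
  set lam : ℝ := LF + 1 with hlam
  have hlam0 : 0 < lam := by positivity
  let W : C(Icc t T, EucSp n) → ℝ → EucSp n :=
    fun z r => Real.exp (lam * r) • z (projIcc t T htT r)
  have hW : ∀ z, Continuous (W z) := fun z =>
    (by fun_prop : Continuous fun r : ℝ => Real.exp (lam * r)).smul
      (z.continuous.comp continuous_projIcc)
  have hint : ∀ z, IntegrableOn (fun r => F (W z r) (d r)) (Icc t T) := fun z =>
    integrableOn_vectorField hFcont hD (isCompact_Icc.image (hW z)) hd
      (hW z).aestronglyMeasurable fun s hs => mem_image_of_mem _ hs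
  let Φ : C(Icc t T, EucSp n) → C(Icc t T, EucSp n) := fun z =>
    { toFun := fun s => Real.exp (-(lam * s)) • (x + ∫ r in t..s, F (W z r) (d r))
      continuous_toFun := by
        have h := hint z
        rw [← uIcc_of_le htT] at h
        have h := intervalIntegral.continuousOn_primitive_interval h
        rw [uIcc_of_le htT] at h
        have h := continuousOn_iff_continuous_domRestrict.1 h
        exact (by fun_prop : Continuous fun s : Icc t T => Real.exp (-(lam * s))).smul
          (continuous_const.add h) }
  have hΦ : ∀ z (s : Icc t T), Φ z s =
      Real.exp (-(lam * s)) • (x + ∫ r in t..s, F (W z r) (d r)) := fun _ _ => rfl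
  obtain ⟨q, hq⟩ : ∃ q : NNReal, (q : ℝ) = LF / lam :=
    ⟨_, Real.coe_toNNReal _ (by positivity)⟩
  have hcontr : ContractingWith q Φ := by
    refine ⟨?_, LipschitzWith.of_dist_le_mul fun z w => ?_⟩
    · rw [← NNReal.coe_lt_coe, hq]
      exact (div_lt_one hlam0).2 (by linarith)
    rw [ContinuousMap.dist_le (by positivity)]
    rintro ⟨s, hs⟩
    have hsub : uIcc t s ⊆ Icc t T := by
      rw [uIcc_of_le hs.1]
      exact Icc_subset_Icc_right hs.2
    have hbound : ‖∫ r in t..s, (F (W z r) (d r) - F (W w r) (d r))‖ ≤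
        ∫ r in t..s, LF * dist z w * Real.exp (lam * r) := by
      refine intervalIntegral.norm_integral_le_of_norm_le hs.1 (ae_of_all _ fun r hr => ?_)
        (Continuous.intervalIntegrable (by fun_prop) _ _)
      refine (hFlip _ _ _ (hd.2 r ⟨hr.1.le, hr.2.trans hs.2⟩)).trans ?_
      rw [mul_assoc, ← smul_sub, norm_smul, Real.norm_of_nonneg (Real.exp_pos _).le,
        mul_comm (Real.exp _), ← dist_eq_norm]
      gcongr
      exact ContinuousMap.dist_apply_le_dist _
    have heq : dist (Φ z ⟨s, hs⟩) (Φ w ⟨s, hs⟩) = Real.exp (-(lam * s)) *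
        ‖∫ r in t..s, (F (W z r) (d r) - F (W w r) (d r))‖ := by
      rw [dist_eq_norm, hΦ, hΦ, ← smul_sub, norm_smul, Real.norm_of_nonneg (Real.exp_pos _).le,
        add_sub_add_left_eq_sub, intervalIntegral.integral_sub
          ((hint z).mono_set hsub).intervalIntegrable ((hint w).mono_set hsub).intervalIntegrable]
    rw [heq, hq]
    calc _ ≤ Real.exp (-(lam * s)) * ∫ r in t..s, LF * dist z w * Real.exp (lam * r) := by gcongr
      _ = LF * dist z w * (Real.exp (-(lam * s)) * ∫ r in t..s, Real.exp (lam * r)) := by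
        rw [intervalIntegral.integral_const_mul]
        ring
      _ ≤ LF * dist z w * (1 / lam) := by
        gcongr
        exact exp_neg_mul_integral_exp_le hlam0
      _ = LF / lam * dist z w := by ring
  have : Nonempty (Icc t T) := ⟨⟨t, left_mem_Icc.2 htT⟩⟩
  obtain ⟨z, hz⟩ : ∃ z, Φ z = z := ⟨_, hcontr.fixedPoint_isFixedPt⟩
  have hsol : ∀ s ∈ Icc t T, W z s = x + ∫ r in t..s, F (W z r) (d r) := by
    intro s hs
    have h : Real.exp (-(lam * s)) • (x + ∫ r in t..s, F (W z r) (d r)) = z ⟨s, hs⟩ := by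
      rw [← hΦ z ⟨s, hs⟩, hz]
    simp only [W] at h ⊢
    rw [projIcc_of_mem htT hs, ← h, smul_smul, ← Real.exp_add, add_neg_cancel, Real.exp_zero,
      one_smul]
  refine ⟨W z, ?_, hsol⟩
  rw [hsol t (left_mem_Icc.2 htT), intervalIntegral.integral_same, add_zero]

theorem exists_forall_le_of_continuous {ι α : Type*} [Finite ι] [TopologicalSpace α]
    {f : ι → α → ℝ} (hf : ∀ i, Continuous (f i)) {S : Set α} (hS : IsCompact S) :
    ∃ M, ∀ i, ∀ p ∈ S, f i p ≤ M := by
  choose B hB using fun i => hS.bddAbove_image (hf i).continuousOn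
  obtain ⟨M, hM⟩ := (Set.finite_range B).bddAbove
  exact ⟨M, fun i p hp => (hB i (mem_image_of_mem _ hp)).trans (hM (mem_range_self i))⟩

theorem payoff_le_iff {n nX nTR : ℕ} (hnX : 0 < nX) (hnTR : 0 < nTR)
    {g : Fin nX → EucSp n → ℝ → ℝ} {l : Fin nTR → EucSp n → ℝ} {t T : ℝ} (htT : t ≤ T)
    {y : ℝ → EucSp n} {M : ℝ} (hM : ∀ i, ∀ s ∈ Icc t T, g i (y s) s ≤ M) {c : ℝ} :
    payoff g l t T y ≤ c ↔ (∀ j, l j (y T) ≤ c) ∧ ∀ i, ∀ s ∈ Icc t T, g i (y s) s ≤ c := by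
  have : Nonempty (Fin nX) := ⟨⟨0, hnX⟩⟩
  have : Nonempty (Fin nTR) := ⟨⟨0, hnTR⟩⟩
  have hbdd : ∀ i, BddAbove ((fun s => g i (y s) s) '' Icc t T) := fun i =>
    ⟨M, forall_mem_image.2 (hM i)⟩
  rw [payoff, max_le_iff, ciSup_le_iff (Set.finite_range _).bddAbove,
    ciSup_le_iff (Set.finite_range _).bddAbove]
  refine and_congr_right fun _ => forall_congr' fun i => ?_
  rw [csSup_le_iff (hbdd i) ((nonempty_Icc.2 htT).image _), forall_mem_image]

/-- A Lipschitz estimate for the value function in the state variable. -/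
theorem stmt1
    {n m nX nTR : ℕ} (hn : 0 < n) (hm : 0 < m) (hnX : 0 < nX) (hnTR : 0 < nTR)
    (T : ℝ) (hT : 0 < T)
    (D : Set (EucSp m)) (hDne : D.Nonempty) (hDcomp : IsCompact D)
    (F : EucSp n → EucSp m → EucSp n)
    (hFcont : Continuous fun p : EucSp n × EucSp m => F p.1 p.2)
    (LF : ℝ) (hLF : 0 ≤ LF)
    (hFlip : ∀ x y : EucSp n, ∀ d ∈ D, ‖F x d - F y d‖ ≤ LF * ‖x - y‖)
    (g : Fin nX → EucSp n → ℝ → ℝ) (l : Fin nTR → EucSp n → ℝ)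
    (hg : ∀ i, LocallyLipschitz fun p : EucSp n × ℝ => g i p.1 p.2)
    (hl : ∀ j, LocallyLipschitz (l j))
    (u : EucSp n → ℝ → ℝ) (hu : IsValueFun F D g l T u)
    (𝒳 K : Set (EucSp n)) (h𝒳 : IsCompact 𝒳) (hK : IsCompact K)
    (hKtraj : ∀ x ∈ 𝒳, ∀ t ∈ Set.Icc (0:ℝ) T, ∀ (d : ℝ → EucSp m) (y : ℝ → EucSp n),
      Admissible D t T d → IsTraj F d t T x y → ∀ s ∈ Set.Icc t T, y s ∈ K)
    (Ll Lg : ℝ) (hLl : 0 ≤ Ll) (hLg : 0 ≤ Lg)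
    (hLl' : ∀ j, ∀ x ∈ K, ∀ z ∈ K, |l j x - l j z| ≤ Ll * ‖x - z‖)
    (hLg' : ∀ i, ∀ x ∈ K, ∀ z ∈ K, ∀ s ∈ Set.Icc (0:ℝ) T,
      |g i x s - g i z s| ≤ Lg * ‖x - z‖) :
    ∀ x₁ ∈ 𝒳, ∀ x₂ ∈ 𝒳, ∀ t ∈ Set.Icc (0:ℝ) T,
      |u x₁ t - u x₂ t| ≤ max Ll Lg * Real.exp (LF * T) * ‖x₁ - x₂‖ := by
  intro x₁ hx₁ x₂ hx₂ t ht
  have htT : t ≤ T := ht.2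
  have hsub : ∀ s ∈ Icc t T, s ∈ Icc 0 T := fun s hs => ⟨ht.1.trans hs.1, hs.2⟩
  obtain ⟨Mg, hMg⟩ := exists_forall_le_of_continuous (fun i => (hg i).continuous)
    (hK.prod (isCompact_Icc (a := (0 : ℝ)) (b := T)))
  obtain ⟨Ml, hMl⟩ := exists_forall_le_of_continuous (fun j => (hl j).continuous) hK
  have hgM : ∀ x ∈ 𝒳, ∀ d y, Admissible D t T d → IsTraj F d t T x y →
      ∀ i, ∀ s ∈ Icc t T, g i (y s) s ≤ Mg := fun x hx d y hd hy i s hs =>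
    hMg i (y s, s) ⟨hKtraj x hx t ht d y hd hy s hs, hsub s hs⟩
  have hbdd : ∀ x ∈ 𝒳, BddAbove {r | ∃ d y, Admissible D t T d ∧ IsTraj F d t T x y ∧
      r = payoff g l t T y} := by
    rintro x hx
    refine ⟨max Ml Mg, ?_⟩
    rintro _ ⟨d, y, hd, hy, rfl⟩
    refine (payoff_le_iff hnX hnTR htT (hgM x hx d y hd hy)).2 ⟨fun j => ?_, fun i s hs => ?_⟩
    · exact (hMl j _ (hKtraj x hx t ht d y hd hy T (right_mem_Icc.2 htT))).trans (le_max_left _ _)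
    · exact (hgM x hx d y hd hy i s hs).trans (le_max_right _ _)
  have key : ∀ x ∈ 𝒳, ∀ x' ∈ 𝒳,
      u x t ≤ u x' t + max Ll Lg * Real.exp (LF * T) * ‖x - x'‖ := by
    intro x hx x' hx'
    rw [hu x t ht, hu x' t ht]
    refine csSup_le ?_ ?_
    · obtain ⟨d₀, hd₀⟩ := hDne
      have hd : Admissible D t T fun _ => d₀ := ⟨measurable_const, fun _ _ => hd₀⟩
      obtain ⟨y, hy⟩ := exists_isTraj hFcont hDcomp hLF hFlip htT hd x
      exact ⟨_, _, y, hd, hy, rfl⟩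
    rintro _ ⟨d, y, hd, hy, rfl⟩
    obtain ⟨y', hy'⟩ := exists_isTraj hFcont hDcomp hLF hFlip htT hd x'
    have hyK := hKtraj x hx t ht d y hd hy
    have hyK' := hKtraj x' hx' t ht d y' hd hy'
    have hdist : ∀ s ∈ Icc t T, ‖y s - y' s‖ ≤ Real.exp (LF * T) * ‖x - x'‖ := by
      intro s hs
      refine (hy.norm_sub_le hLF hFlip htT hd hy' (hy.integrableOn hFcont hDcomp hK hd hyK)
        (hy'.integrableOn hFcont hDcomp hK hd hyK') s hs).trans ?_
      rw [mul_comm]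
      gcongr
      linarith [ht.1, hs.2]
    have hmax : 0 ≤ max Ll Lg := hLl.trans (le_max_left _ _)
    have hpay := (payoff_le_iff hnX hnTR (l := l) htT (hgM x' hx' d y' hd hy')).1 le_rfl
    suffices h : payoff g l t T y ≤
        payoff g l t T y' + max Ll Lg * Real.exp (LF * T) * ‖x - x'‖ from
      h.trans (add_le_add (le_csSup (hbdd x' hx') ⟨d, y', hd, hy', rfl⟩) le_rfl)
    refine (payoff_le_iff hnX hnTR htT (hgM x hx d y hd hy)).2 ⟨fun j => ?_, fun i s hs => ?_⟩
    · have hT' : T ∈ Icc t T := right_mem_Icc.2 htT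
      have h₁ := (le_abs_self _).trans (hLl' j _ (hyK T hT') _ (hyK' T hT'))
      have h₂ : Ll * ‖y T - y' T‖ ≤ max Ll Lg * (Real.exp (LF * T) * ‖x - x'‖) :=
        mul_le_mul (le_max_left _ _) (hdist T hT') (norm_nonneg _) hmax
      linarith [hpay.1 j]
    · have h₁ := (le_abs_self _).trans (hLg' i _ (hyK s hs) _ (hyK' s hs) s (hsub s hs))
      have h₂ : Lg * ‖y s - y' s‖ ≤ max Ll Lg * (Real.exp (LF * T) * ‖x - x'‖) :=
        mul_le_mul (le_max_right _ _) (hdist s hs) (norm_nonneg _) hmax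
      linarith [hpay.2 i s hs]
  have h₁ := key x₁ hx₁ x₂ hx₂
  have h₂ := key x₂ hx₂ x₁ hx₁
  rw [norm_sub_rev x₂ x₁] at h₂
  exact abs_sub_le_iff.2 ⟨by linarith, by linarith⟩

end
end

section
/- If ψ is a C^∞ function on ℝ^n × [0,T] satisfying (i) ∂_t ψ(x,t) + ⟨∇_x ψ(x,t), F(x,d)⟩ ≤ 0 for all (t,x,d) ∈ [0,T] × ℝ^n × 𝒟, (ii) ψ(x,t) ≥ g_i(x,t) for all (x,t) ∈ ℝ^n × [0,T] and all i = 1,…,n_X, and (iii) ψ(x,T) ≥ l_j(x) for all x ∈ ℝ^n and all j = 1,…,n_TR, then {x ∈ ℝ^n : ψ(x,0) ≤ 0} ⊆ ℛ_0. -/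
open Set MeasureTheory RealInnerProductSpace Filter Topology

noncomputable section

/-- Carathéodory existence theorem for an integral equation `y s = x + ∫ r in a..s, G r (y r)`
whose right-hand side is globally Lipschitz in the state. -/
theorem exists_integral_solution {E : Type*} [NormedAddCommGroup E] [NormedSpace ℝ E]
    [CompleteSpace E] {a b : ℝ} (hab : a ≤ b) {G : ℝ → E → E} {L : ℝ} (hL : 0 ≤ L)
    (hlip : ∀ r ∈ Icc a b, ∀ x y, ‖G r x - G r y‖ ≤ L * ‖x - y‖)
    (hint : ∀ y : ℝ → E, Continuous y → IntervalIntegrable (fun r => G r (y r)) volume a b)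
    (x : E) :
    ∃ y : ℝ → E, Continuous y ∧ ∀ s ∈ Icc a b, y s = x + ∫ r in a..s, G r (y r) := by
  -- Banach's fixed point theorem in the variable `z s = exp (-k * s) • y s`
  set k : ℝ := 2 * L + 1 with hk
  have hkpos : 0 < k := by positivity
  let ext (z : C(Icc a b, E)) (r : ℝ) : E := Real.exp (k * r) • z (projIcc a b hab r)
  have hext (z : C(Icc a b, E)) : Continuous (ext z) :=
    Continuous.smul (by fun_prop) (z.continuous.comp continuous_projIcc)
  have hsub {s : ℝ} (hs : s ∈ Icc a b) (z : C(Icc a b, E)) :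
      IntervalIntegrable (fun r => G r (ext z r)) volume a s := by
    refine (hint _ (hext z)).mono_set ?_
    rw [uIcc_of_le hs.1, uIcc_of_le hab]
    exact Icc_subset_Icc_right hs.2
  let Φ (z : C(Icc a b, E)) : C(Icc a b, E) :=
    { toFun := fun s => Real.exp (-(k * s)) • (x + ∫ r in a..s, G r (ext z r))
      continuous_toFun := by
        have hprim := intervalIntegral.continuousOn_primitive_interval' (hint _ (hext z))
          left_mem_uIcc
        rw [uIcc_of_le hab] at hprim
        exact Continuous.smul (by fun_prop) (continuous_const.add hprim.domRestrict) }
  have hexp (s : ℝ) : ∫ r in a..s, L * Real.exp (k * r)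
      = L / k * (Real.exp (k * s) - Real.exp (k * a)) := by
    rw [intervalIntegral.integral_eq_sub_of_hasDerivAt
      (f := fun r => L / k * Real.exp (k * r))]
    · ring
    · intro r _
      have := (((hasDerivAt_id r).const_mul k).exp).const_mul (L / k)
      convert! this using 1
      simp
      field_simp
    · exact Continuous.intervalIntegrable (by fun_prop) _ _
  have hcontr : ContractingWith (1 / 2) Φ := by
    refine ⟨by
      rw [← NNReal.coe_lt_coe]
      norm_num, LipschitzWith.of_dist_le_mul fun z w => ?_⟩
    rw [ContinuousMap.dist_le (by positivity)]
    intro s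
    have hbound : ‖∫ r in a..s, (G r (ext z r) - G r (ext w r))‖
        ≤ ∫ r in a..s, (L * Real.exp (k * r)) * dist z w := by
      refine intervalIntegral.norm_integral_le_of_norm_le s.2.1 (.of_forall fun r hr => ?_)
        (Continuous.intervalIntegrable (by fun_prop) _ _)
      refine (hlip r ⟨hr.1.le, hr.2.trans s.2.2⟩ _ _).trans ?_
      rw [mul_assoc, ← smul_sub, norm_smul, Real.norm_of_nonneg (Real.exp_pos _).le,
        ← dist_eq_norm]
      gcongr
      exact ContinuousMap.dist_apply_le_dist _
    rw [intervalIntegral.integral_mul_const, hexp] at hbound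
    have hdist : dist (Φ z s) (Φ w s) = Real.exp (-(k * s)) *
        ‖∫ r in a..s, (G r (ext z r) - G r (ext w r))‖ := by
      rw [intervalIntegral.integral_sub (hsub s.2 z) (hsub s.2 w), dist_eq_norm]
      change ‖Real.exp (-(k * s)) • (x + ∫ r in a..s, G r (ext z r))
        - Real.exp (-(k * s)) • (x + ∫ r in a..s, G r (ext w r))‖ = _
      rw [← smul_sub, norm_smul, Real.norm_of_nonneg (Real.exp_pos _).le,
        add_sub_add_left_eq_sub]
    have hLk : L / k ≤ 1 / 2 := by
      rw [div_le_div_iff₀ hkpos two_pos]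
      linarith
    rw [hdist]
    calc Real.exp (-(k * s)) * ‖∫ r in a..s, (G r (ext z r) - G r (ext w r))‖
        ≤ Real.exp (-(k * s)) * (1 / 2 * Real.exp (k * s) * dist z w) := by
          gcongr
          refine hbound.trans ?_
          refine mul_le_mul_of_nonneg_right (mul_le_mul hLk
            (sub_le_self _ (Real.exp_pos _).le) (sub_nonneg.2 ?_) (by norm_num)) dist_nonneg
          gcongr
          exact s.2.1
      _ = 1 / 2 * dist z w * (Real.exp (-(k * s)) * Real.exp (k * s)) := by ring
      _ = ((1 / 2 : NNReal) : ℝ) * dist z w := by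
          rw [← Real.exp_add]
          simp
  obtain ⟨z, hz, -⟩ := hcontr.exists_fixedPoint 0 (edist_ne_top _ _)
  refine ⟨ext z, hext z, fun s hs => ?_⟩
  have hzs : z ⟨s, hs⟩ = Real.exp (-(k * s)) • (x + ∫ r in a..s, G r (ext z r)) :=
    congrArg (fun w : C(Icc a b, E) => w ⟨s, hs⟩) hz.symm
  calc ext z s = Real.exp (k * s) • z ⟨s, hs⟩ := by
        simp only [ext, projIcc_of_mem hab hs]
    _ = x + ∫ r in a..s, G r (ext z r) := by
        rw [hzs, smul_smul, ← Real.exp_add]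
        simp

/-- A `C¹` function whose derivative along an absolutely continuous curve with bounded velocity
is nonpositive does not increase along that curve. -/
theorem le_of_fderiv_along_primitive_nonpos {E : Type*} [NormedAddCommGroup E]
    [NormedSpace ℝ E] [CompleteSpace E] {φ : E × ℝ → ℝ} (hφ : ContDiff ℝ 1 φ) {a b : ℝ}
    (hab : a ≤ b) {v : ℝ → E} (hv : IntervalIntegrable v volume a b) {C : ℝ}
    (hC : ∀ r ∈ Icc a b, ‖v r‖ ≤ C) (x : E)
    (hdec : ∀ s ∈ Icc a b, fderiv ℝ φ (x + ∫ r in a..s, v r, s) (v s, 1) ≤ 0) :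
    φ (x + ∫ r in a..b, v r, b) ≤ φ (x, a) := by
  have hsub {s : ℝ} (hs : s ∈ Icc a b) : IntervalIntegrable v volume a s := by
    refine hv.mono_set ?_
    rw [uIcc_of_le hs.1, uIcc_of_le hab]
    exact Icc_subset_Icc_right hs.2
  have hprim : LipschitzOnWith C.toNNReal (fun s => x + ∫ r in a..s, v r) (Icc a b) := by
    refine LipschitzOnWith.of_dist_le_mul fun s hs t ht => ?_
    rw [dist_add_left, dist_eq_norm,
      intervalIntegral.integral_interval_sub_left (hsub hs) (hsub ht), Real.dist_eq,
      Real.coe_toNNReal C ((norm_nonneg _).trans (hC s hs))]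
    refine intervalIntegral.norm_integral_le_of_norm_le_const fun r hr => hC r ?_
    exact uIcc_subset_Icc ht hs (uIoc_subset_uIcc hr)
  have hcurve := hprim.prodMk (LipschitzWith.id.lipschitzOnWith (s := Icc a b))
  obtain ⟨K, hK⟩ := (hφ.locallyLipschitz.locallyLipschitzOn
    (s := (fun s => (x + ∫ r in a..s, v r, s)) '' Icc a b)).exists_lipschitzOnWith_of_compact
    (isCompact_Icc.image_of_continuousOn hcurve.continuousOn)
  have hcomp := hK.comp hcurve (mapsTo_image _ _)
  rw [← uIcc_of_le hab] at hcomp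
  have hftc := hcomp.absolutelyContinuousOnInterval.integral_deriv_eq_sub
  have hneg : 0 ≤ ∫ s in a..b, -deriv (fun s => φ (x + ∫ r in a..s, v r, s)) s := by
    refine intervalIntegral.integral_nonneg_of_ae_restrict hab ?_
    rw [EventuallyLE, ae_restrict_iff' measurableSet_Icc]
    filter_upwards [hv.ae_hasDerivAt_integral] with s hs hsab
    have hder := (hs (Icc_subset_uIcc hsab) a left_mem_uIcc).const_add x
    have hφs := (hφ.differentiable one_ne_zero (x + ∫ r in a..s, v r, s)).hasFDerivAt
    have hchain := HasFDerivAt.comp_hasDerivAt (f := fun s => (x + ∫ r in a..s, v r, s)) s hφs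
      (hder.prodMk (hasDerivAt_id s))
    have hval : deriv (fun s => φ (x + ∫ r in a..s, v r, s)) s
        = fderiv ℝ φ (x + ∫ r in a..s, v r, s) (v s, 1) := hchain.deriv
    simpa [hval] using hdec s hsab
  rw [intervalIntegral.integral_neg] at hneg
  simp only [Function.comp_def, intervalIntegral.integral_same, add_zero, id] at hftc
  linarith

/-- The total derivative of a function of space and time, split into its time derivative and
its spatial gradient. -/
theorem fderiv_apply_eq_deriv_add_inner_gradient {E : Type*} [NormedAddCommGroup E]
    [InnerProductSpace ℝ E] [CompleteSpace E] {ψ : E → ℝ → ℝ} {x : E} {t : ℝ}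
    (hψ : DifferentiableAt ℝ (fun p : E × ℝ => ψ p.1 p.2) (x, t)) (v : E) :
    fderiv ℝ (fun p : E × ℝ => ψ p.1 p.2) (x, t) (v, 1)
      = deriv (ψ x) t + ⟪gradient (fun z => ψ z t) x, v⟫ := by
  have htime : HasDerivAt (ψ x) (fderiv ℝ (fun p : E × ℝ => ψ p.1 p.2) (x, t) (0, 1)) t :=
    HasFDerivAt.comp_hasDerivAt (f := fun s => (x, s)) t hψ.hasFDerivAt
      ((hasDerivAt_const t x).prodMk (hasDerivAt_id t))
  have hspace : HasFDerivAt (fun z => ψ z t)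
      ((fderiv ℝ (fun p : E × ℝ => ψ p.1 p.2) (x, t)).comp (.inl ℝ E ℝ)) x :=
    HasFDerivAt.comp (f := fun z => (z, t)) x hψ.hasFDerivAt (hasFDerivAt_prodMk_left x t)
  rw [htime.deriv, gradient, InnerProductSpace.toDual_symm_apply, hspace.fderiv]
  simp [← map_add]

/-- If a smooth `ψ` decreases along the vector field `F`, dominates all
`gᵢ` on `ℝⁿ × [0, T]` and dominates all `lⱼ` at time `T`, then its zero sub-level set at
time `0` is contained in the backward reachable set `ℛ₀`. -/
theorem stmt9
    {n m nX nTR : ℕ} (hn : 0 < n) (hm : 0 < m) (hnX : 0 < nX) (hnTR : 0 < nTR)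
    (T : ℝ) (hT : 0 < T)
    (D : Set (EucSp m)) (hDne : D.Nonempty) (hDcomp : IsCompact D)
    (F : EucSp n → EucSp m → EucSp n)
    (hFcont : Continuous fun p : EucSp n × EucSp m => F p.1 p.2)
    (LF : ℝ) (hLF : 0 ≤ LF)
    (hFlip : ∀ x y : EucSp n, ∀ d ∈ D, ‖F x d - F y d‖ ≤ LF * ‖x - y‖)
    (g : Fin nX → EucSp n → ℝ → ℝ) (l : Fin nTR → EucSp n → ℝ)
    (hg : ∀ i, LocallyLipschitz fun p : EucSp n × ℝ => g i p.1 p.2)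
    (hl : ∀ j, LocallyLipschitz (l j))
    (f : EucSp n → EucSp m → EucSp n)
    (hfcont : Continuous fun p : EucSp n × EucSp m => f p.1 p.2)
    (hflip : ∀ K : Set (EucSp n), IsCompact K → ∃ L, 0 ≤ L ∧
      ∀ x ∈ K, ∀ y ∈ K, ∀ d ∈ D, ‖f x d - f y d‖ ≤ L * ‖x - y‖)
    (R : ℝ) (hR : 0 < R)
    (Bset : Set (EucSp n)) (hB : Bset = {x : EucSp n | ∑ i, x i ^ 2 ≤ R})
    (hFf : ∀ x ∈ Bset, ∀ d ∈ D, F x d = f x d)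
    (hXB : ∀ t ∈ Set.Icc (0:ℝ) T, {x : EucSp n | ∀ i, g i x t ≤ 0} ⊆ Bset)
    (hTRB : {x : EucSp n | ∀ j, l j x ≤ 0} ⊆ Bset)
    (ψ : EucSp n → ℝ → ℝ)
    (hψ : ContDiff ℝ (⊤ : ℕ∞) (fun p : EucSp n × ℝ => ψ p.1 p.2))
    (hdecr : ∀ t ∈ Set.Icc (0:ℝ) T, ∀ x : EucSp n, ∀ d ∈ D,
      deriv (ψ x) t + ⟪gradient (fun z => ψ z t) x, F x d⟫ ≤ 0)
    (hgψ : ∀ x : EucSp n, ∀ t ∈ Set.Icc (0:ℝ) T, ∀ i, g i x t ≤ ψ x t)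
    (hlψ : ∀ x : EucSp n, ∀ j, l j x ≤ ψ x T) :
    {x : EucSp n | ψ x 0 ≤ 0} ⊆ Reach f D g l 0 T := by
  intro x hx d hd
  have hmeas {y : ℝ → EucSp n} (hy : Continuous y) : Measurable fun r => F (y r) (d r) :=
    hFcont.measurable.comp (hy.measurable.prodMk hd.1)
  have hbdd {y : ℝ → EucSp n} (hy : Continuous y) :
      ∃ C, ∀ r ∈ Icc 0 T, ‖F (y r) (d r)‖ ≤ C := by
    obtain ⟨C, hC⟩ := (((isCompact_Icc (a := (0 : ℝ)) (b := T)).image hy).prod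
      hDcomp).exists_bound_of_continuousOn hFcont.continuousOn
    exact ⟨C, fun r hr => hC (y r, d r) ⟨mem_image_of_mem y hr, hd.2 r hr⟩⟩
  have hint {y : ℝ → EucSp n} (hy : Continuous y) :
      IntervalIntegrable (fun r => F (y r) (d r)) volume 0 T := by
    obtain ⟨C, hC⟩ := hbdd hy
    rw [intervalIntegrable_iff_integrableOn_Icc_of_le hT.le]
    exact Measure.integrableOn_of_bounded (M := C) (by simp) (hmeas hy).aestronglyMeasurable
      ((ae_restrict_iff' measurableSet_Icc).2 (.of_forall hC))
  obtain ⟨y, hycont, hy⟩ := exists_integral_solution (G := fun r z => F z (d r)) hT.le hLF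
    (fun r hr z w => hFlip z w _ (hd.2 r hr)) (fun _ => hint) x
  obtain ⟨C, hC⟩ := hbdd hycont
  have hψy : ∀ s ∈ Icc 0 T, ψ (y s) s ≤ 0 := by
    intro s hs
    have hsub : Icc 0 s ⊆ Icc 0 T := Icc_subset_Icc_right hs.2
    have hle := le_of_fderiv_along_primitive_nonpos (hψ.of_le (by exact_mod_cast le_top)) hs.1
      ((hint hycont).mono_set (by rwa [uIcc_of_le hs.1, uIcc_of_le hT.le]))
      (fun r hr => hC r (hsub hr)) x fun r hr => by
        rw [← hy r (hsub hr), fderiv_apply_eq_deriv_add_inner_gradient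
          (hψ.differentiable (by simp) _)]
        exact hdecr r (hsub hr) _ _ (hd.2 r (hsub hr))
    rw [← hy s hs] at hle
    exact hle.trans hx
  have hgy : ∀ s ∈ Icc 0 T, ∀ i, g i (y s) s ≤ 0 := fun s hs i =>
    (hgψ _ s hs i).trans (hψy s hs)
  refine ⟨y, ⟨by simpa using hy 0 (left_mem_Icc.2 hT.le), fun s hs => ?_⟩, hgy,
    fun j => (hlψ _ j).trans (hψy T (right_mem_Icc.2 hT.le))⟩
  rw [hy s hs]
  congr 1
  refine intervalIntegral.integral_congr fun r hr => ?_
  rw [uIcc_of_le hs.1] at hr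
  have hrT : r ∈ Icc 0 T := Icc_subset_Icc_right hs.2 hr
  exact hFf _ (hXB r hrT (hgy r hrT)) _ (hd.2 r hrT)

end
end

section
/- Assume additionally that ∂X_t ∩ ∂B = ∅ for every t ∈ [0,T]. If ψ is a C^∞ function on ℝ^n × [0,T] satisfying (i) ∂_t ψ(x,t) + ⟨∇_x ψ(x,t), f(x,d)⟩ ≤ 0 for all (x,t,d) ∈ B × [0,T] × 𝒟, (ii) ψ(x,t) ≥ g_i(x,t) for all (x,t) ∈ B × [0,T] and all i = 1,…,n_X, and (iii) ψ(x,T) ≥ l_j(x) for all x ∈ B and all j = 1,…,n_TR, then {x ∈ B : ψ(x,0) ≤ 0} ⊆ ℛ_0. -/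
open Set MeasureTheory RealInnerProductSpace Filter Topology

noncomputable section

section Caratheodory

theorem integral_mul_exp_two_mul (L t : ℝ) :
    ∫ r in (0 : ℝ)..t, L * Real.exp (2 * L * r) = (Real.exp (2 * L * t) - 1) / 2 := by
  have h : ∀ r ∈ uIcc 0 t, HasDerivAt (fun r => Real.exp (2 * L * r) / 2)
      (L * Real.exp (2 * L * r)) r := by
    intro r _
    have h1 : HasDerivAt (fun r : ℝ => 2 * L * r) (2 * L) r := by
      simpa using (hasDerivAt_id r).const_mul (2 * L)
    exact (h1.exp.div_const 2).congr_deriv (by ring)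
  rw [intervalIntegral.integral_eq_sub_of_hasDerivAt h
    (Continuous.intervalIntegrable (by fun_prop) _ _)]
  simp
  ring

theorem intervalIntegrable_of_norm_le {E : Type*} [NormedAddCommGroup E] {v : ℝ → E} {M : ℝ}
    (hv : StronglyMeasurable v) (hM : ∀ r, ‖v r‖ ≤ M) (a b : ℝ) :
    IntervalIntegrable v volume a b :=
  (intervalIntegrable_const (c := M)).mono_fun hv.aestronglyMeasurable
    (Eventually.of_forall fun r => (hM r).trans (le_abs_self M))

variable {E : Type*} [NormedAddCommGroup E] [NormedSpace ℝ E]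

theorem lipschitzWith_integral_of_norm_le {v : ℝ → E} {M : ℝ} (hv : StronglyMeasurable v)
    (hM : ∀ r, ‖v r‖ ≤ M) (x : E) :
    LipschitzWith M.toNNReal (fun s => x + ∫ r in (0 : ℝ)..s, v r) := by
  have hM0 : 0 ≤ M := (norm_nonneg _).trans (hM 0)
  refine LipschitzWith.of_dist_le_mul fun s t => ?_
  rw [dist_add_left, dist_eq_norm, intervalIntegral.integral_interval_sub_left
    (intervalIntegrable_of_norm_le hv hM _ _) (intervalIntegrable_of_norm_le hv hM _ _),
    Real.coe_toNNReal _ hM0, Real.dist_eq]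
  exact intervalIntegral.norm_integral_le_of_norm_le_const fun r _ => hM r

/-- The velocities along the Picard iterates of `ẏ = G(s, y)`, `y 0 = x`. -/
def picardVelocity (G : ℝ → E → E) (x : E) : ℕ → ℝ → E
  | 0 => 0
  | k + 1 => (Ici 0).indicator fun s => G s (x + ∫ r in (0 : ℝ)..s, picardVelocity G x k r)

theorem norm_picardVelocity_le {G : ℝ → E → E} {M : ℝ} (hM : ∀ r z, ‖G r z‖ ≤ M) (x : E)
    (k : ℕ) (r : ℝ) : ‖picardVelocity G x k r‖ ≤ M := by
  have hM0 : 0 ≤ M := (norm_nonneg _).trans (hM 0 0)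
  cases k with
  | zero => simpa [picardVelocity] using hM0
  | succ k => exact (norm_indicator_le_norm_self _ _).trans (hM _ _)

theorem stronglyMeasurable_picardVelocity [MeasurableSpace E] [BorelSpace E]
    [SecondCountableTopology E] {G : ℝ → E → E} {M : ℝ}
    (hG : StronglyMeasurable (Function.uncurry G)) (hM : ∀ r z, ‖G r z‖ ≤ M) (x : E) (k : ℕ) :
    StronglyMeasurable (picardVelocity G x k) := by
  induction k with
  | zero => exact stronglyMeasurable_zero
  | succ k ih =>
    refine StronglyMeasurable.indicator ?_ measurableSet_Ici
    exact hG.comp_measurable (measurable_id.prodMk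
      (lipschitzWith_integral_of_norm_le ih (norm_picardVelocity_le hM x k) x).continuous.measurable)

theorem norm_picardVelocity_sub_le [MeasurableSpace E] [BorelSpace E]
    [SecondCountableTopology E] {G : ℝ → E → E} {M L : ℝ}
    (hG : StronglyMeasurable (Function.uncurry G)) (hM : ∀ r z, ‖G r z‖ ≤ M) (hL0 : 0 ≤ L)
    (hL : ∀ r z w, ‖G r z - G r w‖ ≤ L * ‖z - w‖) (x : E) (k : ℕ) (s : ℝ) :
    ‖picardVelocity G x k s - picardVelocity G x (k + 1) s‖ ≤
      M * Real.exp (2 * L * s) * (1 / 2) ^ k := by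
  have hM0 : 0 ≤ M := (norm_nonneg _).trans (hM 0 0)
  induction k generalizing s with
  | zero =>
    by_cases hs : s ∈ Ici (0 : ℝ)
    · have h1 := norm_picardVelocity_le hM x 1 s
      have h2 : 1 ≤ Real.exp (2 * L * s) := Real.one_le_exp (mul_nonneg (by positivity) hs)
      simp only [picardVelocity, Pi.zero_apply, zero_sub, norm_neg, pow_zero, mul_one] at h1 ⊢
      nlinarith
    · simp only [picardVelocity, Pi.zero_apply, indicator_of_notMem hs, sub_zero, norm_zero]
      positivity
  | succ k ih =>
    by_cases hs : s ∈ Ici (0 : ℝ)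
    · have hi := fun j => intervalIntegrable_of_norm_le
        (stronglyMeasurable_picardVelocity hG hM x j) (norm_picardVelocity_le hM x j) 0 s
      have h1 : ‖∫ r in (0 : ℝ)..s, (picardVelocity G x k r - picardVelocity G x (k + 1) r)‖ ≤
          ∫ r in (0 : ℝ)..s, M * Real.exp (2 * L * r) * (1 / 2) ^ k :=
        intervalIntegral.norm_integral_le_of_norm_le hs
          (Eventually.of_forall fun r _ => ih r)
          (Continuous.intervalIntegrable (by fun_prop) _ _)
      have h2 : L * ∫ r in (0 : ℝ)..s, M * Real.exp (2 * L * r) * (1 / 2) ^ k =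
          M * (1 / 2) ^ k * ((Real.exp (2 * L * s) - 1) / 2) := by
        rw [← integral_mul_exp_two_mul, ← intervalIntegral.integral_const_mul,
          ← intervalIntegral.integral_const_mul]
        congr 1
        ext r
        ring
      rw [picardVelocity, picardVelocity, indicator_of_mem hs, indicator_of_mem hs]
      refine (hL _ _ _).trans ?_
      rw [add_sub_add_left_eq_sub, ← intervalIntegral.integral_sub (hi k) (hi (k + 1))]
      refine (mul_le_mul_of_nonneg_left h1 hL0).trans ?_
      rw [h2, pow_succ]
      have : 0 ≤ M * (1 / 2) ^ k := by positivity
      nlinarith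
    · rw [picardVelocity, picardVelocity, indicator_of_notMem hs, indicator_of_notMem hs, sub_zero,
        norm_zero]
      positivity

/-- Global existence for a Carathéodory equation `ẏ = G(s, y)`, `y 0 = x`, whose right-hand side
is bounded and Lipschitz in `y`, expressed through the velocity `v` of the solution. -/
theorem exists_velocity_of_caratheodory [CompleteSpace E] [MeasurableSpace E] [BorelSpace E]
    [SecondCountableTopology E] {G : ℝ → E → E} {M L : ℝ}
    (hG : StronglyMeasurable (Function.uncurry G)) (hM : ∀ r z, ‖G r z‖ ≤ M) (hL0 : 0 ≤ L)
    (hL : ∀ r z w, ‖G r z - G r w‖ ≤ L * ‖z - w‖) (x : E) :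
    ∃ v : ℝ → E, StronglyMeasurable v ∧ (∀ s, ‖v s‖ ≤ M) ∧
      ∀ s, 0 ≤ s → v s = G s (x + ∫ r in (0 : ℝ)..s, v r) := by
  have hcauchy (s : ℝ) : CauchySeq fun k => picardVelocity G x k s :=
    cauchySeq_of_le_geometric (1 / 2) (M * Real.exp (2 * L * s)) (by norm_num) fun k => by
      rw [dist_eq_norm]
      exact norm_picardVelocity_sub_le hG hM hL0 hL x k s
  choose v hv using fun s => cauchySeq_tendsto_of_complete (hcauchy s)
  have hmeas := stronglyMeasurable_picardVelocity hG hM x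
  refine ⟨v, stronglyMeasurable_of_tendsto atTop hmeas (tendsto_pi_nhds.2 hv),
    fun s => le_of_tendsto (hv s).norm
      (Eventually.of_forall fun k => norm_picardVelocity_le hM x k s), fun s hs => ?_⟩
  have hint : Tendsto (fun k => ∫ r in (0 : ℝ)..s, picardVelocity G x k r) atTop
      (𝓝 (∫ r in (0 : ℝ)..s, v r)) :=
    intervalIntegral.tendsto_integral_filter_of_dominated_convergence (fun _ => M)
      (Eventually.of_forall fun k => (hmeas k).aestronglyMeasurable)
      (Eventually.of_forall fun k => Eventually.of_forall fun r _ =>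
        norm_picardVelocity_le hM x k r)
      intervalIntegrable_const (Eventually.of_forall fun r _ => hv r)
  have hGs : LipschitzWith L.toNNReal (G s) := LipschitzWith.of_dist_le_mul fun z w => by
    rw [dist_eq_norm, dist_eq_norm, Real.coe_toNNReal _ hL0]
    exact hL s z w
  refine tendsto_nhds_unique ((tendsto_add_atTop_iff_nat 1).2 (hv s)) ?_
  refine ((hGs.continuous.tendsto _).comp (hint.const_add x)).congr fun k => ?_
  rw [picardVelocity, indicator_of_mem (show s ∈ Ici (0 : ℝ) from hs), Function.comp_apply]

end Caratheodory

/-- A `C¹` function whose derivative along a Lipschitz curve is nonpositive decreases. -/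
theorem le_of_deriv_along_nonpos {E : Type*} [NormedAddCommGroup E] [InnerProductSpace ℝ E]
    [CompleteSpace E] {ψ : E → ℝ → ℝ} (hψ : ContDiff ℝ 1 fun p : E × ℝ => ψ p.1 p.2)
    {v : ℝ → E} {M : ℝ} (hv : StronglyMeasurable v) (hM : ∀ r, ‖v r‖ ≤ M) {x : E} {y : ℝ → E}
    (hy : y = fun s => x + ∫ r in (0 : ℝ)..s, v r) {t : ℝ} (ht : 0 ≤ t)
    (hdecr : ∀ s ∈ Icc 0 t,
      deriv (ψ (y s)) s + ⟪gradient (fun z => ψ z s) (y s), v s⟫ ≤ 0) :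
    ψ (y t) t ≤ ψ (y 0) 0 := by
  have hylip : LipschitzWith M.toNNReal y := hy ▸ lipschitzWith_integral_of_norm_le hv hM x
  have hplip : LipschitzWith (max M.toNNReal 1) fun s => (y s, s) := hylip.prodMk LipschitzWith.id
  obtain ⟨K, hK⟩ := (hψ.locallyLipschitz.locallyLipschitzOn
    (s := (fun s => (y s, s)) '' uIcc 0 t)).exists_lipschitzOnWith_of_compact
      (isCompact_uIcc.image hplip.continuous)
  have hac : AbsolutelyContinuousOnInterval (fun s => ψ (y s) s) 0 t :=
    (hK.comp (hplip.lipschitzOnWith (s := uIcc 0 t))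
      (mapsTo_image _ _)).absolutelyContinuousOnInterval
  have hderiv := (intervalIntegrable_of_norm_le hv hM 0 t).ae_hasDerivAt_integral
  have hnonpos : ∀ᵐ s, s ∈ Icc 0 t → deriv (fun s => ψ (y s) s) s ≤ 0 := by
    filter_upwards [hderiv] with s hs hst
    have hy' : HasDerivAt y (v s) s := by
      rw [hy]
      exact (hs (by rwa [uIcc_of_le ht]) 0 (by simp)).const_add x
    have hψ' := (hψ.differentiable one_ne_zero (y s, s)).hasFDerivAt
    have h1 : HasDerivAt (fun s => ψ (y s) s) _ s :=
      hψ'.comp_hasDerivAt (f := fun s => (y s, s)) s (hy'.prodMk (hasDerivAt_id s))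
    have h2 : HasDerivAt (ψ (y s)) _ s :=
      hψ'.comp_hasDerivAt (f := fun r => (y s, r)) s ((hasDerivAt_const s (y s)).prodMk (hasDerivAt_id s))
    have h3 : HasFDerivAt (fun z => ψ z s) _ (y s) :=
      hψ'.comp (f := fun z => (z, s)) (y s) ((hasFDerivAt_id (y s)).prodMk (hasFDerivAt_const s (y s)))
    have h := hdecr s hst
    rw [inner_gradient_left, h2.deriv, h3.fderiv] at h
    rw [h1.deriv]
    refine le_of_eq_of_le ?_ h
    simp [← map_add]
  have hint := intervalIntegral.integral_nonneg_of_ae_restrict (μ := volume) ht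
    (f := fun s => -deriv (fun s => ψ (y s) s) s)
    ((ae_restrict_iff' measurableSet_Icc).2
      (hnonpos.mono fun s hs hst => neg_nonneg.2 (hs hst)))
  rw [intervalIntegral.integral_neg, hac.integral_deriv_eq_sub] at hint
  linarith

/-- The coordinatewise truncation of a vector to the cube `[-a, a]ⁿ`. -/
def clampVec {n : ℕ} (a : ℝ) (x : EucSp n) : EucSp n :=
  WithLp.toLp 2 fun i => max (min (x i) a) (-a)

theorem norm_clampVec_sub_le {n : ℕ} (a : ℝ) (x y : EucSp n) :
    ‖clampVec a x - clampVec a y‖ ≤ ‖x - y‖ := by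
  rw [EuclideanSpace.norm_eq, EuclideanSpace.norm_eq]
  refine Real.sqrt_le_sqrt (Finset.sum_le_sum fun i _ => ?_)
  refine pow_le_pow_left₀ (norm_nonneg _) ?_ 2
  exact (abs_max_sub_max_le_abs _ _ _).trans (by
    simpa using abs_inf_sub_inf_le_abs (x i) (y i) a)

theorem norm_clampVec_le {n : ℕ} {a : ℝ} (ha : 0 ≤ a) (x : EucSp n) :
    ‖clampVec a x‖ ≤ √(∑ _i : Fin n, a ^ 2) := by
  rw [EuclideanSpace.norm_eq]
  refine Real.sqrt_le_sqrt (Finset.sum_le_sum fun i _ => ?_)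
  refine pow_le_pow_left₀ (norm_nonneg _) ?_ 2
  exact abs_le.2 ⟨le_max_right _ _, max_le (min_le_right _ _) (by linarith)⟩

theorem clampVec_eq_self {n : ℕ} {a : ℝ} {x : EucSp n} (hx : ∀ i, |x i| ≤ a) :
    clampVec a x = x := by
  ext i
  have h := abs_le.1 (hx i)
  simp [clampVec, h.1, h.2]

theorem subset_interior_of_frontier_inter_eq_empty {X : Type*} [TopologicalSpace X] {s t : Set X}
    (hst : s ⊆ t) (h : frontier s ∩ frontier t = ∅) : s ⊆ interior t := by
  intro x hx
  by_contra hxt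
  exact eq_empty_iff_forall_notMem.1 h x
    ⟨⟨subset_closure hx, fun hxs => hxt (interior_mono hst hxs)⟩, subset_closure (hst hx), hxt⟩

/-- A continuous curve starting in a closed set `B` stays in `B` if it can only reach interior
points of `B` as long as it has remained in `B`. -/
theorem mem_of_forall_mem_interior {X : Type*} [TopologicalSpace X] {B : Set X} (hB : IsClosed B)
    {y : ℝ → X} (hy : Continuous y) {T : ℝ} (h0 : y 0 ∈ B)
    (hstep : ∀ s ∈ Icc 0 T, (∀ r ∈ Icc 0 s, y r ∈ B) → y s ∈ interior B) :
    ∀ s ∈ Icc 0 T, y s ∈ B := by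
  set S : Set ℝ := {s | ∀ r, 0 ≤ r → r < s → y r ∈ B} with hS
  have hclosed : IsClosed S := by
    have : S = ⋂ r ∈ {r | 0 ≤ r ∧ y r ∉ B}, Iic r := by
      ext s
      simp only [hS, mem_ofPred_eq, mem_iInter, mem_Iic, and_imp]
      exact forall_congr' fun r => forall_congr' fun _ => by
        rw [← not_lt, not_imp_not]
    rw [this]
    exact isClosed_biInter fun r _ => isClosed_Iic
  have hmem : ∀ s ∈ S, 0 ≤ s → ∀ r ∈ Icc 0 s, y r ∈ B := by
    intro s hs hs0 r hr
    rcases hr.2.lt_or_eq with h | rfl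
    · exact hs r hr.1 h
    rcases hs0.eq_or_lt with rfl | h
    · exact h0
    refine hB.mem_of_tendsto ((hy.tendsto r).mono_left nhdsWithin_le_nhds)
      (?_ : ∀ᶠ q in 𝓝[<] r, _)
    filter_upwards [Ioo_mem_nhdsLT h] with q hq using hs q hq.1.le hq.2
  have hsub : Icc 0 T ⊆ S := by
    refine (hclosed.inter isClosed_Icc).Icc_subset_of_forall_mem_nhdsWithin
      (fun r h h' => absurd h' h.not_gt) fun s hs => ?_
    have hnear : ∀ᶠ q in 𝓝 s, y q ∈ B := by
      filter_upwards [hy.continuousAt.preimage_mem_nhds (isOpen_interior.mem_nhds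
        (hstep s ⟨hs.2.1, hs.2.2.le⟩ (hmem s hs.1 hs.2.1)))] with q hq using interior_subset hq
    obtain ⟨ε, hε, hball⟩ := Metric.eventually_nhds_iff.1 hnear
    filter_upwards [Ioo_mem_nhdsGT (show s < s + ε by linarith)] with q hq r hr hrq
    rcases le_or_gt r s with h | h
    · exact hmem s hs.1 hs.2.1 r ⟨hr, h⟩
    · refine hball ?_
      rw [Real.dist_eq, abs_lt]
      constructor <;> linarith [hq.2]
  exact fun s hs => hmem s (hsub hs) hs.1 s ⟨hs.1, le_rfl⟩

/-- If additionally `∂X_t ∩ ∂B = ∅` for all `t ∈ [0, T]`, a smooth `ψ`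
satisfying the decrease and domination conditions only on `B × [0, T]` yields the
inner-approximation `{x ∈ B | ψ(x, 0) ≤ 0} ⊆ ℛ₀`. -/
theorem stmt10
    {n m nX nTR : ℕ} (hn : 0 < n) (hm : 0 < m) (hnX : 0 < nX) (hnTR : 0 < nTR)
    (T : ℝ) (hT : 0 < T)
    (D : Set (EucSp m)) (hDne : D.Nonempty) (hDcomp : IsCompact D)
    (g : Fin nX → EucSp n → ℝ → ℝ) (l : Fin nTR → EucSp n → ℝ)
    (hg : ∀ i, LocallyLipschitz fun p : EucSp n × ℝ => g i p.1 p.2)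
    (hl : ∀ j, LocallyLipschitz (l j))
    (f : EucSp n → EucSp m → EucSp n)
    (hfcont : Continuous fun p : EucSp n × EucSp m => f p.1 p.2)
    (hflip : ∀ K : Set (EucSp n), IsCompact K → ∃ L, 0 ≤ L ∧
      ∀ x ∈ K, ∀ y ∈ K, ∀ d ∈ D, ‖f x d - f y d‖ ≤ L * ‖x - y‖)
    (R : ℝ) (hR : 0 < R)
    (Bset : Set (EucSp n)) (hB : Bset = {x : EucSp n | ∑ i, x i ^ 2 ≤ R})
    (hXB : ∀ t ∈ Set.Icc (0:ℝ) T, {x : EucSp n | ∀ i, g i x t ≤ 0} ⊆ Bset)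
    (hTRB : {x : EucSp n | ∀ j, l j x ≤ 0} ⊆ Bset)
    (hfr : ∀ t ∈ Set.Icc (0:ℝ) T,
      frontier {x : EucSp n | ∀ i, g i x t ≤ 0} ∩ frontier Bset = ∅)
    (ψ : EucSp n → ℝ → ℝ)
    (hψ : ContDiff ℝ (⊤ : ℕ∞) (fun p : EucSp n × ℝ => ψ p.1 p.2))
    (hdecr : ∀ x ∈ Bset, ∀ t ∈ Set.Icc (0:ℝ) T, ∀ d ∈ D,
      deriv (ψ x) t + ⟪gradient (fun z => ψ z t) x, f x d⟫ ≤ 0)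
    (hgψ : ∀ x ∈ Bset, ∀ t ∈ Set.Icc (0:ℝ) T, ∀ i, g i x t ≤ ψ x t)
    (hlψ : ∀ x ∈ Bset, ∀ j, l j x ≤ ψ x T) :
    {x ∈ Bset | ψ x 0 ≤ 0} ⊆ Reach f D g l 0 T := by
  rintro x ⟨hxB, hx0⟩ d ⟨hdmeas, hdD⟩
  obtain ⟨d₀, hd₀⟩ := hDne
  have hBabs : ∀ z ∈ Bset, ∀ i, |z i| ≤ √R := by
    intro z hz i
    rw [hB] at hz
    exact Real.abs_le_sqrt ((Finset.single_le_sum (f := fun i => z i ^ 2)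
      (fun j _ => sq_nonneg _) (Finset.mem_univ i)).trans hz)
  have hBclosed : IsClosed Bset := by
    rw [hB]
    exact isClosed_le (by fun_prop) continuous_const
  -- Extend the uncertainty and truncate the dynamics, so that solutions exist globally.
  let δ : ℝ → EucSp m := (Icc 0 T).piecewise d fun _ => d₀
  have hδmeas : Measurable δ := hdmeas.piecewise measurableSet_Icc measurable_const
  have hδD : ∀ s, δ s ∈ D := by
    intro s
    by_cases hs : s ∈ Icc 0 T
    · simpa [δ, piecewise_eq_of_mem _ _ _ hs] using hdD s hs
    · simpa [δ, piecewise_eq_of_notMem _ _ _ hs] using hd₀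
  let K : Set (EucSp n) := Metric.closedBall 0 (√(∑ _i : Fin n, √R ^ 2))
  have hK : IsCompact K := isCompact_closedBall _ _
  have hclampK : ∀ z : EucSp n, clampVec √R z ∈ K := fun z =>
    mem_closedBall_zero_iff.2 (norm_clampVec_le (Real.sqrt_nonneg R) z)
  obtain ⟨L, hL0, hL⟩ := hflip K hK
  obtain ⟨M, hM⟩ := (hK.prod hDcomp).exists_bound_of_continuousOn hfcont.continuousOn
  have hclamp : Continuous (clampVec (n := n) √R) :=
    (LipschitzWith.of_dist_le_mul (K := 1) fun z w => by
      simpa [dist_eq_norm] using norm_clampVec_sub_le √R z w).continuous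
  have hG : StronglyMeasurable (Function.uncurry fun s z => f (clampVec √R z) (δ s)) :=
    (hfcont.measurable.comp ((hclamp.measurable.comp measurable_snd).prodMk
      (hδmeas.comp measurable_fst))).stronglyMeasurable
  obtain ⟨v, hvmeas, hvM, hv⟩ := exists_velocity_of_caratheodory hG
    (fun r z => hM (clampVec √R z, δ r) ⟨hclampK z, hδD r⟩) hL0
    (fun r z w => (hL _ (hclampK z) _ (hclampK w) _ (hδD r)).trans
      (mul_le_mul_of_nonneg_left (norm_clampVec_sub_le _ _ _) hL0)) x
  obtain ⟨y, hy⟩ : ∃ y : ℝ → EucSp n, y = fun s => x + ∫ r in (0 : ℝ)..s, v r := ⟨_, rfl⟩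
  have hy0 : y 0 = x := by simp [hy]
  have hycont : Continuous y :=
    hy ▸ (lipschitzWith_integral_of_norm_le hvmeas hvM x).continuous
  have hvf : ∀ s ∈ Icc 0 T, y s ∈ Bset → v s = f (y s) (d s) := by
    intro s hs hys
    rw [hv s hs.1, ← congrFun hy s, clampVec_eq_self (hBabs _ hys)]
    simp [δ, piecewise_eq_of_mem _ _ _ hs]
  have hψy : ∀ s ∈ Icc 0 T, (∀ r ∈ Icc 0 s, y r ∈ Bset) → ψ (y s) s ≤ 0 := by
    intro s hs hyB
    refine (le_of_deriv_along_nonpos (hψ.of_le (by exact_mod_cast le_top)) hvmeas hvM hy hs.1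
      fun r hr => ?_).trans (by rwa [hy0])
    have hrT : r ∈ Icc 0 T := ⟨hr.1, hr.2.trans hs.2⟩
    rw [hvf r hrT (hyB r hr)]
    exact hdecr _ (hyB r hr) r hrT _ (hdD r hrT)
  have hgy : ∀ s ∈ Icc 0 T, (∀ r ∈ Icc 0 s, y r ∈ Bset) → ∀ i, g i (y s) s ≤ 0 :=
    fun s hs hyB i => (hgψ _ (hyB s ⟨hs.1, le_rfl⟩) s hs i).trans (hψy s hs hyB)
  have hyB : ∀ s ∈ Icc 0 T, y s ∈ Bset :=
    mem_of_forall_mem_interior hBclosed hycont (by rwa [hy0]) fun s hs hyB =>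
      subset_interior_of_frontier_inter_eq_empty (hXB s hs) (hfr s hs) (hgy s hs hyB)
  have hyB' : ∀ s ∈ Icc 0 T, ∀ r ∈ Icc 0 s, y r ∈ Bset :=
    fun s hs r hr => hyB r ⟨hr.1, hr.2.trans hs.2⟩
  have hTmem : T ∈ Icc 0 T := ⟨hT.le, le_rfl⟩
  refine ⟨y, ⟨hy0, fun s hs => ?_⟩, fun s hs => hgy s hs (hyB' s hs),
    fun j => (hlψ _ (hyB T hTmem) j).trans (hψy T hTmem (hyB' T hTmem))⟩
  rw [congrFun hy s]
  congr 1
  refine intervalIntegral.integral_congr fun r hr => ?_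
  rw [uIcc_of_le hs.1] at hr
  exact hvf r ⟨hr.1, hr.2.trans hs.2⟩ (hyB' s hs r hr)

end
end
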